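/- Let (X,d) be a complete separable metric space, I=[a,b] a compact interval with normalized Lebesgue measure λ, and let f: I×X → (-∞,∞] be a normal integrand. Assume there exists a proper function l: X → [0,∞) (i.e., with compact sublevel sets) and an integrable function g: I → ℝ such that f(t,x) ≥ l(x)(1+d(x,x₀)) + g(t) for some x₀ ∈ X. Then for each C ∈ ℝ, the set of Young measures η ∈ 𝒴₁(I,X) satisfying ∫ f dη ≤ C is compact. -/

import Mathlib

open MeasureTheory Filter Topology Set ENNReal

noncomputable section

/-!
`(X,d)` is a complete separable metric space, `I = [a,b]` carries the normalized
Lebesgue measure `lam a b`.  A Young measure is a Borel probability measure on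
`I × X` (modelled on `ℝ × X`) with finite first moment whose marginal on `I` is
`lam a b`.  The Kantorovich–Rubinstein space `𝒴₁(I,X)` is metric, so compactness
coincides with sequential compactness; convergence is expressed through convergence
of the integrals of all continuous functions of at most linear growth.  A normal
integrand takes values in `(-∞,∞]`, modelled by `EReal`; its integral is the
difference of the `ℝ≥0∞`-integrals of its positive and negative parts.  A function
`l : X → [0,∞)` is proper when its sublevel sets are compact.
-/

/-- Normalized Lebesgue measure on the interval `[a,b]`. -/
def lam (a b : ℝ) : Measure ℝ := (ENNReal.ofReal (b - a))⁻¹ • (volume.restrict (Icc a b))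

/-- Young measures on `I × X` with finite first moment whose marginal on `I` is
the normalized Lebesgue measure. -/
def IsYoungMeasure {X : Type*} [MetricSpace X] [MeasurableSpace X]
    (a b : ℝ) (x₀ : X) (η : Measure (ℝ × X)) : Prop :=
  IsProbabilityMeasure η ∧ η.map Prod.fst = lam a b ∧
    Integrable (fun p : ℝ × X => dist x₀ p.2) η

/-- Convergence in the Kantorovich–Rubinstein space `𝒴₁(I,X)`. -/
def Y1Tendsto {X : Type*} [MetricSpace X] [MeasurableSpace X] (x₀ : X)
    (ηs : ℕ → Measure (ℝ × X)) (η : Measure (ℝ × X)) : Prop :=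
  ∀ f : ℝ × X → ℝ, Continuous f → (∃ C : ℝ, ∀ p, |f p| ≤ C * (1 + dist x₀ p.2)) →
    Tendsto (fun n => ∫ p, f p ∂(ηs n)) atTop (𝓝 (∫ p, f p ∂η))

/-- The nonnegative part of an extended real, as an `ℝ≥0∞`. -/
def epos (x : EReal) : ℝ≥0∞ := if x = ⊤ then ⊤ else ENNReal.ofReal x.toReal

/-- The integral of an `EReal`-valued function: positive part minus negative part. -/
def eInt {α : Type*} [MeasurableSpace α] (μ : Measure α) (f : α → EReal) : EReal :=
  ((∫⁻ x, epos (f x) ∂μ : ℝ≥0∞) : EReal) - ((∫⁻ x, epos (-f x) ∂μ : ℝ≥0∞) : EReal)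

lemma exists_compact_of_range (μ : Measure ℝ) [IsFiniteMeasure μ] (φ : (ℕ → ℕ) → ℝ)
    (hφ : Continuous φ) (r : ℝ≥0∞) (hr : r < μ (range φ)) :
    ∃ K ⊆ range φ, IsCompact K ∧ r ≤ μ K := by
  have step : ∀ (k : ℕ) (A : Set (ℕ → ℕ)), r < μ (φ '' A) →
      ∃ m : ℕ, r < μ (φ '' (A ∩ {x | x k ≤ m})) := by
    intro k A hA
    have h1 : φ '' A = ⋃ m : ℕ, φ '' (A ∩ {x | x k ≤ m}) := by
      rw [← image_iUnion, ← inter_iUnion]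
      congr 1
      ext x
      simp only [mem_inter_iff, mem_iUnion, mem_ofPred_eq]
      exact ⟨fun h => ⟨h, x k, le_rfl⟩, fun h => h.1⟩
    rw [h1, Monotone.measure_iUnion] at hA
    · exact lt_iSup_iff.1 hA
    · intro i j hij
      apply image_mono
      rintro x ⟨hx, hx'⟩
      exact ⟨hx, le_trans hx' hij⟩
  choose m hm using step
  let A : ℕ → {A : Set (ℕ → ℕ) // r < μ (φ '' A)} := fun k =>
    Nat.rec ⟨univ, by rwa [image_univ]⟩
      (fun k A => ⟨A.1 ∩ {x | x k ≤ m k A.1 A.2}, hm k A.1 A.2⟩) k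
  let n : ℕ → ℕ := fun k => m k (A k).1 (A k).2
  have hA : ∀ k, (A (k+1)).1 = (A k).1 ∩ {x | x k ≤ n k} := fun k => rfl
  have hA' : ∀ k, ∀ x ∈ (A k).1, ∀ i < k, x i ≤ n i := by
    intro k
    induction k with
    | zero => intro x _ i hi; omega
    | succ k ih =>
      intro x hx i hi
      rw [hA] at hx
      rcases Nat.lt_succ_iff_lt_or_eq.1 hi with h | h
      · exact ih x hx.1 i h
      · subst h; exact hx.2
  have hK : IsCompact (Set.pi univ fun k => Iic (n k)) :=
    isCompact_univ_pi fun k => (finite_Iic (n k)).isCompact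
  refine ⟨φ '' (Set.pi univ fun k => Iic (n k)), image_subset_range _ _, hK.image hφ, ?_⟩
  by_contra! hlt
  obtain ⟨U, hKU, hU, hUr⟩ := Set.exists_isOpen_lt_of_lt _ _ hlt
  have key : ∃ k, φ '' (A k).1 ⊆ U := by
    by_contra! hno
    have : ∀ k, ∃ x ∈ (A k).1, φ x ∉ U := by
      intro k
      obtain ⟨y, ⟨x, hx, rfl⟩, hy⟩ := not_subset.1 (hno k)
      exact ⟨x, hx, hy⟩
    choose x hx hxU using this
    obtain ⟨y, hy, ψ, hψ, hlim⟩ := hK.tendsto_subseq (x := fun k i => min (x k i) (n i))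
      (fun k i _ => mem_Iic.2 (min_le_right _ _))
    have hlim' : Tendsto (fun j => x (ψ j)) atTop (𝓝 y) := by
      rw [tendsto_pi_nhds] at hlim ⊢
      intro i
      refine (hlim i).congr' ?_
      filter_upwards [hψ.tendsto_atTop.eventually_gt_atTop i] with j hj
      exact min_eq_left (hA' _ _ (hx (ψ j)) i hj)
    have : φ y ∈ Uᶜ := hU.isClosed_compl.mem_of_tendsto ((hφ.tendsto y).comp hlim')
      (Eventually.of_forall fun j => hxU (ψ j))
    exact this (hKU ⟨y, hy, rfl⟩)
  obtain ⟨k, hk⟩ := key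
  exact absurd ((A k).2.trans_le (measure_mono hk)) (not_lt.2 hUr.le)

lemma analytic_nullMeasurable (μ : Measure ℝ) [IsFiniteMeasure μ] (s : Set ℝ)
    (hs : AnalyticSet s) : NullMeasurableSet s μ := by
  rw [AnalyticSet] at hs
  rcases hs with rfl | ⟨φ, hφ, rfl⟩
  · exact MeasurableSet.empty.nullMeasurableSet
  by_cases h0 : μ (range φ) = 0
  · exact NullMeasurableSet.of_null h0
  have : ∀ k : ℕ, ∃ K ⊆ range φ, IsCompact K ∧ μ (range φ) ≤ μ K + ((k : ℝ≥0∞) + 1)⁻¹ := by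
    intro k
    obtain ⟨K, hK, hc, hr⟩ := exists_compact_of_range μ φ hφ (μ (range φ) - ((k : ℝ≥0∞) + 1)⁻¹)
      (ENNReal.sub_lt_self (measure_ne_top _ _) h0 (by simp))
    exact ⟨K, hK, hc, tsub_le_iff_right.1 hr⟩
  choose K hK hc hr using this
  have hm : MeasurableSet (⋃ k, K k) := MeasurableSet.iUnion fun k => (hc k).measurableSet
  refine hm.nullMeasurableSet.congr ?_
  refine ae_eq_of_subset_of_measure_ge (iUnion_subset hK) ?_ hm.nullMeasurableSet
    (measure_ne_top _ _)
  have h1 : Tendsto (fun k : ℕ => μ (⋃ k, K k) + ((k : ℝ≥0∞) + 1)⁻¹) atTop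
      (𝓝 (μ (⋃ k, K k) + 0)) := by
    refine Tendsto.const_add _ ?_
    have := (tendsto_add_atTop_iff_nat 1).2 ENNReal.tendsto_inv_nat_nhds_zero
    simpa using this
  rw [add_zero] at h1
  exact ge_of_tendsto' h1 fun k => (hr k).trans (by gcongr; exact subset_iUnion _ _)

section
variable {X : Type*} [MetricSpace X] [CompleteSpace X] [SecondCountableTopology X]
    [MeasurableSpace X] [BorelSpace X]

lemma open_hull (μ : Measure ℝ) [IsFiniteMeasure μ] (B : Set (ℝ × X)) (hB : MeasurableSet B)
    (hBo : ∀ t, IsOpen {x | (t, x) ∈ B}) (ε : ℝ≥0∞) (hε : ε ≠ 0) :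
    ∃ W : Set (ℝ × X), IsOpen W ∧ B ⊆ W ∧
      ∀ η : Measure (ℝ × X), η.map Prod.fst = μ → η W ≤ η B + ε := by
  classical
  let ι := TopologicalSpace.countableBasis X
  have : Countable ι := (TopologicalSpace.countable_countableBasis X).to_subtype
  obtain ⟨δ, hδ, hδs⟩ := ENNReal.exists_pos_sum_of_countable' hε ι
  let T : ι → Set ℝ := fun i => {t | ∀ x ∈ i.1, (t, x) ∈ B}
  have hT : ∀ i, NullMeasurableSet (T i) μ := by
    intro i
    have h1 : (T i)ᶜ = Prod.fst '' ((univ ×ˢ i.1) \ B) := by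
      ext t
      simp [T]
    have h2 : MeasurableSet (((univ : Set ℝ) ×ˢ i.1) \ B) :=
      (MeasurableSet.univ.prod
        (TopologicalSpace.isOpen_of_mem_countableBasis i.2).measurableSet).diff hB
    have h3 := analytic_nullMeasurable μ _ (h1 ▸ h2.analyticSet.image_of_continuous continuous_fst)
    simpa using h3.compl
  have hV : ∀ i, ∃ V ⊇ T i, IsOpen V ∧ μ (V \ T i) ≤ δ i := by
    intro i
    obtain ⟨V, h1, h2, h3⟩ := (T i).exists_isOpen_lt_add (measure_ne_top μ _) (hδ i).ne'
    refine ⟨V, h1, h2, ?_⟩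
    rw [measure_sdiff h1 (hT i) (measure_ne_top _ _)]
    exact tsub_le_iff_left.2 h3.le
  choose V hTV hVo hVδ using hV
  refine ⟨⋃ i, V i ×ˢ i.1, isOpen_iUnion fun i => (hVo i).prod
    (TopologicalSpace.isOpen_of_mem_countableBasis i.2), ?_, ?_⟩
  · rintro ⟨t, x⟩ h
    obtain ⟨U, hU, hxU, hUB⟩ := (TopologicalSpace.isBasis_countableBasis X).exists_subset_of_mem_open
      (show x ∈ {x | (t, x) ∈ B} from h) (hBo t)
    exact mem_iUnion.2 ⟨⟨U, hU⟩, hTV _ (fun y hy => hUB hy), hxU⟩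
  · intro η hη
    have hsub : (⋃ i, V i ×ˢ i.1) ⊆ B ∪ ⋃ i, Prod.fst ⁻¹' (V i \ T i) := by
      rintro ⟨t, x⟩ h
      obtain ⟨i, hi⟩ := mem_iUnion.1 h
      by_cases ht : t ∈ T i
      · exact Or.inl (ht x hi.2)
      · exact Or.inr (mem_iUnion.2 ⟨i, hi.1, ht⟩)
    calc η (⋃ i, V i ×ˢ i.1) ≤ η (B ∪ ⋃ i, Prod.fst ⁻¹' (V i \ T i)) := measure_mono hsub
      _ ≤ η B + η (⋃ i, Prod.fst ⁻¹' (V i \ T i)) := measure_union_le _ _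
      _ ≤ η B + ∑' i, η (Prod.fst ⁻¹' (V i \ T i)) := by gcongr; exact measure_iUnion_le _
      _ ≤ η B + ∑' i, δ i := by
        gcongr with i
        refine (Measure.le_map_apply measurable_fst.aemeasurable _).trans ?_
        rw [hη]; exact hVδ i
      _ ≤ η B + ε := by gcongr

lemma measure_le_liminf (μ : Measure ℝ) [IsFiniteMeasure μ] (η : Measure (ℝ × X))
    (ηs : ℕ → Measure (ℝ × X)) (hηs : ∀ n, (ηs n).map Prod.fst = μ)
    (hopen : ∀ G, IsOpen G → η G ≤ atTop.liminf (fun n => ηs n G))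
    (B : Set (ℝ × X)) (hB : MeasurableSet B)
    (hBo : ∀ t, IsOpen {x | (t, x) ∈ B}) : η B ≤ atTop.liminf (fun n => ηs n B) := by
  refine ENNReal.le_of_forall_pos_le_add fun ε hε _ => ?_
  obtain ⟨W, hW, hBW, h⟩ := open_hull μ B hB hBo ε (by simpa using hε.ne')
  calc η B ≤ η W := measure_mono hBW
    _ ≤ atTop.liminf (fun n => ηs n W) := hopen W hW
    _ ≤ atTop.liminf (fun n => ηs n B + ε) :=
      liminf_le_liminf (Eventually.of_forall fun n => h _ (hηs n))
    _ = atTop.liminf (fun n => ηs n B) + ε := by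
      exact liminf_add_const atTop _ _ (by isBoundedDefault) (by isBoundedDefault)

lemma lintegral_real_le_liminf (μ : Measure ℝ) [IsFiniteMeasure μ] (η : Measure (ℝ × X))
    (ηs : ℕ → Measure (ℝ × X)) (hηs : ∀ n, (ηs n).map Prod.fst = μ)
    (hopen : ∀ G, IsOpen G → η G ≤ atTop.liminf (fun n => ηs n G))
    (f : ℝ × X → ℝ) (hf : Measurable f) (hf0 : 0 ≤ f)
    (hfo : ∀ c : ℝ, 0 ≤ c → ∀ t, IsOpen {x | c < f (t, x)}) :
    ∫⁻ p, ENNReal.ofReal (f p) ∂η ≤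
      atTop.liminf (fun n => ∫⁻ p, ENNReal.ofReal (f p) ∂(ηs n)) := by
  simp_rw [lintegral_eq_lintegral_meas_lt _ (Eventually.of_forall hf0) hf.aemeasurable]
  calc ∫⁻ (t : ℝ) in Set.Ioi 0, η {a | t < f a}
      ≤ ∫⁻ (t : ℝ) in Set.Ioi 0, atTop.liminf (fun i ↦ (ηs i) {a | t < f a}) := ?_
    _ ≤ atTop.liminf (fun i ↦ ∫⁻ (t : ℝ) in Set.Ioi 0, (ηs i) {a | t < f a}) := ?_
  · refine setLIntegral_mono' measurableSet_Ioi fun t ht => ?_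
    exact measure_le_liminf μ η ηs hηs hopen _ (measurableSet_lt measurable_const hf)
      (hfo t (le_of_lt ht))
  · exact lintegral_liminf_le (fun n ↦ Antitone.measurable (fun s t hst ↦
            measure_mono (fun ω hω ↦ lt_of_le_of_lt hst hω)))

lemma lintegral_le_liminf (μ : Measure ℝ) [IsFiniteMeasure μ] (η : Measure (ℝ × X))
    (ηs : ℕ → Measure (ℝ × X)) (hηs : ∀ n, (ηs n).map Prod.fst = μ)
    (hopen : ∀ G, IsOpen G → η G ≤ atTop.liminf (fun n => ηs n G))
    (F : ℝ × X → ℝ≥0∞) (hF : Measurable F)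
    (hFl : ∀ t, LowerSemicontinuous fun x => F (t, x)) :
    ∫⁻ p, F p ∂η ≤ atTop.liminf (fun n => ∫⁻ p, F p ∂(ηs n)) := by
  have hne : ∀ (k : ℕ) p, min (F p) k ≠ ⊤ := fun k p =>
    ne_top_of_le_ne_top (ENNReal.natCast_ne_top k) (min_le_right _ _)
  have h1 : ∀ k : ℕ, ∫⁻ p, min (F p) k ∂η ≤ atTop.liminf (fun n => ∫⁻ p, F p ∂(ηs n)) := by
    intro k
    have := lintegral_real_le_liminf μ η ηs hηs hopen (fun p => (min (F p) k).toReal)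
      (hF.min measurable_const).ennreal_toReal (fun p => ENNReal.toReal_nonneg) (by
        intro c hc t
        simp_rw [← ENNReal.ofReal_lt_iff_lt_toReal hc (hne k _), lt_min_iff]
        exact ((hFl t).isOpen_preimage _).inter isOpen_const)
    simp_rw [ENNReal.ofReal_toReal (hne k _)] at this
    exact this.trans (liminf_le_liminf (Eventually.of_forall fun n =>
      lintegral_mono fun p => min_le_left _ _))
  have h2 : ∀ p, F p = ⨆ k : ℕ, min (F p) k := by
    intro p
    refine le_antisymm ?_ (iSup_le fun k => min_le_left _ _)
    rw [← inf_iSup_eq, ENNReal.iSup_natCast]; simp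
  calc ∫⁻ p, F p ∂η = ∫⁻ p, ⨆ k : ℕ, min (F p) k ∂η := by simp_rw [← h2]
    _ = ⨆ k : ℕ, ∫⁻ p, min (F p) k ∂η := by
      refine lintegral_iSup (fun k => hF.min measurable_const) ?_
      intro i j hij p
      exact min_le_min_left _ (by exact_mod_cast hij)
    _ ≤ _ := iSup_le h1

end
lemma epos_eq (x : EReal) : epos x = x.toENNReal := rfl

lemma epos_identity (y : EReal) (c : ℝ) (h : (c : EReal) ≤ y) :
    epos y + ENNReal.ofReal (-c) = epos (y - c) + ENNReal.ofReal c + epos (-y) := by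
  induction y with
  | bot => simp at h
  | top => simp [epos]
  | coe y =>
    have hc : c ≤ y := by exact_mod_cast h
    have e1 : ((y : EReal) - (c : EReal)) = ((y - c : ℝ) : EReal) := rfl
    have e2 : -(y : EReal) = ((-y : ℝ) : EReal) := rfl
    rw [e1, e2]
    have e3 : ∀ z : ℝ, epos (z : EReal) = ENNReal.ofReal z := fun z => by
      rw [epos, if_neg (EReal.coe_ne_top z), EReal.toReal_coe]
    simp only [e3]
    rcases le_total 0 c with h0 | h0
    · rw [ENNReal.ofReal_of_nonpos (p := -c) (by linarith),
        ENNReal.ofReal_of_nonpos (p := -y) (by linarith),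
        ← ENNReal.ofReal_add (by linarith) h0]
      simp
    · rw [ENNReal.ofReal_of_nonpos h0]
      rcases le_total 0 y with h1 | h1
      · rw [ENNReal.ofReal_of_nonpos (p := -y) (by linarith),
          ← ENNReal.ofReal_add h1 (by linarith)]
        simp [sub_eq_add_neg]
      · rw [ENNReal.ofReal_of_nonpos h1, add_zero, zero_add,
          ← ENNReal.ofReal_add (by linarith) (by linarith)]
        congr 1; ring

lemma ereal_arith (P N F Gp Gm : ℝ≥0∞) (h : P + Gm = F + Gp + N) (hN : N ≠ ⊤) (hGp : Gp ≠ ⊤)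
    (hGm : Gm ≠ ⊤) (C : ℝ) :
    ((P : EReal) - (N : EReal) ≤ (C : EReal)) ↔
      F ≤ ENNReal.ofReal (C - (Gp.toReal - Gm.toReal)) ∧ 0 ≤ C - (Gp.toReal - Gm.toReal) := by
  by_cases hF : F = ⊤
  · subst hF
    have hP : P = ⊤ := by
      by_contra hP
      simp at h
      exact absurd h (by simp [hP, hGm])
    subst hP
    lift N to NNReal using hN
    have : ((⊤ : ℝ≥0∞) : EReal) - ((N : ℝ≥0∞) : EReal) = ⊤ := by
      rw [EReal.coe_ennreal_top]; exact EReal.top_sub_coe _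
    rw [this]
    simp
  · have hP : P ≠ ⊤ := by
      rintro rfl
      rw [top_add] at h
      exact absurd h.symm (by simp [hF, hGp, hN])
    lift N to NNReal using hN
    lift P to NNReal using hP
    lift F to NNReal using hF
    lift Gp to NNReal using hGp
    lift Gm to NNReal using hGm
    have h' : (P : ℝ) + Gm = F + Gp + N := by exact_mod_cast h
    have e : (((P : ℝ≥0∞) : EReal) - ((N : ℝ≥0∞) : EReal)) = (((P : ℝ) - (N : ℝ) : ℝ) : EReal) := rfl
    rw [e, EReal.coe_le_coe_iff]
    simp only [ENNReal.coe_toReal]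
    have hF0 : (0 : ℝ) ≤ F := F.2
    rw [← ENNReal.ofReal_coe_nnreal]
    constructor
    · intro hh
      exact ⟨ENNReal.ofReal_le_ofReal (by linarith), by linarith⟩
    · rintro ⟨h1, h2⟩
      rw [ENNReal.ofReal_le_ofReal_iff h2] at h1
      linarith

lemma lsc_of_compact {X : Type*} [MetricSpace X] (l : X → ℝ)
    (hlproper : ∀ c : ℝ, IsCompact {x : X | l x ≤ c}) : LowerSemicontinuous l :=
  lowerSemicontinuous_iff_isClosed_preimage.2 fun c => (hlproper c).isClosed

lemma lsc_L {X : Type*} [MetricSpace X] (l : X → ℝ) (hl0 : ∀ x, 0 ≤ l x)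
    (hl : LowerSemicontinuous l) (x₀ : X) : LowerSemicontinuous fun x => l x * (1 + dist x x₀) := by
  intro x y hy
  have hd : 0 < 1 + dist x x₀ := by positivity
  rcases lt_or_ge y 0 with h | h
  · refine Eventually.of_forall fun z => h.trans_le ?_
    have := hl0 z
    positivity
  have h1 : y / (1 + dist x x₀) < l x := by rwa [div_lt_iff₀ hd]
  obtain ⟨y', h2, h3⟩ := exists_between h1
  have h4 : y < y' * (1 + dist x x₀) := by rwa [div_lt_iff₀ hd] at h2
  have hc : Continuous fun z => y' * (1 + dist z x₀) := by fun_prop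
  filter_upwards [hl x y' h3, hc.continuousAt.eventually (lt_mem_nhds h4)] with z hz1 hz2
  refine hz2.trans_le ?_
  gcongr

lemma exists_bound {X : Type*} [MetricSpace X] (l : X → ℝ) (hlproper : ∀ c : ℝ, IsCompact {x : X | l x ≤ c})
    (x₀ : X) (c : ℝ) : ∃ R : ℝ, 0 ≤ R ∧ ∀ x, l x ≤ c → dist x x₀ ≤ R := by
  obtain ⟨R, hR⟩ := (hlproper c).isBounded.subset_closedBall x₀
  exact ⟨max R 0, le_max_right _ _, fun x hx => (Metric.mem_closedBall.1 (hR hx)).trans (le_max_left _ _)⟩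

section
variable {X : Type*} [MetricSpace X] [CompleteSpace X] [SecondCountableTopology X]
    [MeasurableSpace X] [BorelSpace X]

/-- one-sided convergence. -/
lemma one_sided (μ : Measure ℝ) [IsFiniteMeasure μ] (η : Measure (ℝ × X))
    (ηs : ℕ → Measure (ℝ × X)) (hηs : ∀ n, (ηs n).map Prod.fst = μ)
    [IsProbabilityMeasure η] (hp : ∀ n, IsProbabilityMeasure (ηs n))
    (hopen : ∀ G, IsOpen G → η G ≤ atTop.liminf (fun n => ηs n G))
    (l : X → ℝ) (hl0 : ∀ x, 0 ≤ l x) (hlproper : ∀ c : ℝ, IsCompact {x : X | l x ≤ c}) (x₀ : X)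
    (M : ℝ) (hM : 0 ≤ M)
    (hL : Integrable (fun p : ℝ × X => l p.2 * (1 + dist p.2 x₀)) η)
    (hLs : ∀ n, Integrable (fun p : ℝ × X => l p.2 * (1 + dist p.2 x₀)) (ηs n))
    (hLM : ∀ n, ∫ p : ℝ × X, l p.2 * (1 + dist p.2 x₀) ∂(ηs n) ≤ M)
    (h : ℝ × X → ℝ) (hc : Continuous h) (K : ℝ) (hK : ∀ p, |h p| ≤ K * (1 + dist x₀ p.2))
    (hi : Integrable h η) (his : ∀ n, Integrable h (ηs n)) (ε : ℝ) (hε : 0 < ε) :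
    ∀ᶠ n in atTop, ∫ p, h p ∂η < ∫ p, h p ∂(ηs n) + ε := by
  have hK0 : 0 ≤ K := by
    by_contra! hneg
    have := (abs_nonneg _).trans (hK (0, x₀))
    simp at this; linarith
  obtain ⟨δ, hδ, hδM⟩ : ∃ δ : ℝ, 0 < δ ∧ δ * M ≤ ε / 2 := by
    refine ⟨ε / 2 / (M + 1), by positivity, ?_⟩
    rw [div_mul_eq_mul_div, div_le_iff₀ (by positivity)]
    nlinarith
  obtain ⟨R, hR0, hR⟩ := exists_bound l hlproper x₀ (K / δ)
  set L : ℝ × X → ℝ := fun p => l p.2 * (1 + dist p.2 x₀) with hLdef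
  have hL0 : ∀ p, 0 ≤ L p := fun p => mul_nonneg (hl0 _) (by positivity)
  set A : ℝ := K * (1 + R) + |∫ p, h p ∂η| + ε with hA
  have hlsc := lsc_L l hl0 (lsc_of_compact l hlproper) x₀
  have hLm : Measurable L := hlsc.measurable.comp measurable_snd
  have hG0 : ∀ p, 0 ≤ h p + δ * L p + A := by
    intro p
    have h1 := (abs_le.1 (hK p)).1
    rw [dist_comm] at h1
    have hA' : K * (1 + R) ≤ A := by
      have := abs_nonneg (∫ p, h p ∂η)
      linarith
    have hd : (0 : ℝ) ≤ dist p.2 x₀ := dist_nonneg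
    rcases le_or_gt (l p.2) (K / δ) with h2 | h2
    · have h3 := hR _ h2
      have h4 : K * (1 + dist p.2 x₀) ≤ K * (1 + R) := by gcongr
      have := mul_nonneg hδ.le (hL0 p)
      linarith
    · rw [div_lt_iff₀ hδ] at h2
      have h3 : K * (1 + dist p.2 x₀) ≤ (l p.2 * δ) * (1 + dist p.2 x₀) := by gcongr
      have h4 : δ * L p = (l p.2 * δ) * (1 + dist p.2 x₀) := by simp only [hLdef]; ring
      have : 0 ≤ K * (1 + R) := by positivity
      linarith
  have hlim := lintegral_real_le_liminf μ η ηs hηs hopen (fun p => h p + δ * L p + A)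
    (by fun_prop) hG0 (by
      intro c _ t
      have e1 : LowerSemicontinuous fun x : X => h (t, x) + A :=
        Continuous.lowerSemicontinuous (by fun_prop)
      have e2 : LowerSemicontinuous fun x : X => δ * L (t, x) :=
        (continuous_const_mul δ).comp_lowerSemicontinuous hlsc
          (fun a b hab => mul_le_mul_of_nonneg_left hab hδ.le)
      have e3 := (e1.add e2).isOpen_preimage c
      convert e3 using 1
      ext x
      simp only [mem_preimage, mem_Ioi, mem_ofPred_eq]
      rw [show h (t, x) + δ * L (t, x) + A = h (t, x) + A + δ * L (t, x) by ring])
  have hint : ∀ ν : Measure (ℝ × X), IsProbabilityMeasure ν → Integrable h ν → Integrable L ν →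
      ∫⁻ p, ENNReal.ofReal (h p + δ * L p + A) ∂ν =
        ENNReal.ofReal (∫ p, h p ∂ν + δ * ∫ p, L p ∂ν + A) := by
    intro ν _ i1 i2
    have i3 : Integrable (fun p => h p + δ * L p) ν := i1.add (i2.const_mul δ)
    have i4 : Integrable (fun p => h p + δ * L p + A) ν := i3.add (integrable_const A)
    rw [← ofReal_integral_eq_lintegral_ofReal i4 (Eventually.of_forall hG0)]
    rw [integral_add i3 (integrable_const A), integral_add i1 (i2.const_mul δ),
      integral_const_mul]
    simp
  rw [hint η inferInstance hi hL] at hlim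
  simp_rw [fun n => hint (ηs n) (hp n) (his n) (hLs n)] at hlim
  have hx : 0 < ∫ p, h p ∂η + δ * ∫ p, L p ∂η + A := by
    have h1 := neg_abs_le (∫ p, h p ∂η)
    have h2 : 0 ≤ ∫ p, L p ∂η := integral_nonneg hL0
    have : 0 ≤ K * (1 + R) := by positivity
    have := mul_nonneg hδ.le h2
    linarith
  have hlt : ENNReal.ofReal (∫ p, h p ∂η + δ * ∫ p, L p ∂η + A - ε / 2) <
      atTop.liminf (fun n => ENNReal.ofReal (∫ p, h p ∂(ηs n) + δ * ∫ p, L p ∂(ηs n) + A)) :=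
    lt_of_lt_of_le ((ENNReal.ofReal_lt_ofReal_iff hx).2 (by linarith)) hlim
  filter_upwards [eventually_lt_of_lt_liminf hlt] with n hn
  have h1 := (ENNReal.ofReal_lt_ofReal_iff'.1 hn).1
  have h2 : 0 ≤ δ * ∫ p, L p ∂η := mul_nonneg hδ.le (integral_nonneg hL0)
  have h3 : δ * ∫ p, L p ∂(ηs n) ≤ δ * M := mul_le_mul_of_nonneg_left (hLM n) hδ.le
  linarith

end
/-- Let `f` be a normal integrand such that `f(t,x) ≥ l(x) (1 + d(x,x₀)) + g(t)` for a
proper function `l : X → [0,∞)` (compact sublevel sets) and an integrable `g : I → ℝ`.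
Then for each `C ∈ ℝ` the set of Young measures `η` with `∫ f dη ≤ C` is
(sequentially) compact in `𝒴₁(I,X)`. -/
theorem normal_integrand_sublevel_compact
    {X : Type*} [MetricSpace X] [CompleteSpace X] [SecondCountableTopology X]
    [MeasurableSpace X] [BorelSpace X]
    (a b : ℝ) (hab : a < b) (x₀ : X)
    (f : ℝ × X → EReal) (hfBorel : Measurable f)
    (hfnormal : ∀ t : ℝ, LowerSemicontinuous fun x => f (t, x))
    (l : X → ℝ) (hl0 : ∀ x, 0 ≤ l x) (hlproper : ∀ c : ℝ, IsCompact {x : X | l x ≤ c})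
    (g : ℝ → ℝ) (hg : IntegrableOn g (Icc a b))
    (hbound : ∀ t ∈ Icc a b, ∀ x : X,
      ((l x * (1 + dist x x₀) + g t : ℝ) : EReal) ≤ f (t, x))
    (C : ℝ)
    (ηs : ℕ → Measure (ℝ × X))
    (hηs : ∀ n, IsYoungMeasure a b x₀ (ηs n) ∧ eInt (ηs n) f ≤ (C : EReal)) :
    ∃ (φ : ℕ → ℕ), StrictMono φ ∧
      ∃ η : Measure (ℝ × X), IsYoungMeasure a b x₀ η ∧ eInt η f ≤ (C : EReal) ∧
        Y1Tendsto x₀ (fun n => ηs (φ n)) η := by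
  have hprob : ∀ n, IsProbabilityMeasure (ηs n) := fun n => (hηs n).1.1
  have hmap : ∀ n, (ηs n).map Prod.fst = lam a b := fun n => (hηs n).1.2.1
  have hfin : IsFiniteMeasure (lam a b) := by
    rw [← hmap 0]; infer_instance
  have hba : ENNReal.ofReal (b - a) ≠ 0 := by simpa using hab
  -- a Borel version of g
  have hgae : AEMeasurable g (volume.restrict (Icc a b)) := hg.aestronglyMeasurable.aemeasurable
  set g' : ℝ → ℝ := hgae.mk g with hg'
  have hg'm : Measurable g' := hgae.measurable_mk
  have hac : lam a b ≪ volume.restrict (Icc a b) := Measure.smul_absolutelyContinuous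
  have hgg' : ∀ᵐ t ∂(lam a b), t ∈ Icc a b ∧ g t = g' t := by
    refine hac.ae_le ?_
    filter_upwards [ae_restrict_mem (μ := volume) (measurableSet_Icc (a := a) (b := b)),
      hgae.ae_eq_mk] with t h1 h2
    exact ⟨h1, h2⟩
  have hg'i : Integrable g' (lam a b) :=
    (Integrable.congr hg hgae.ae_eq_mk).smul_measure (ENNReal.inv_ne_top.2 hba)
  set Gp : ℝ≥0∞ := ∫⁻ t, ENNReal.ofReal (g' t) ∂(lam a b) with hGp
  set Gm : ℝ≥0∞ := ∫⁻ t, ENNReal.ofReal (-g' t) ∂(lam a b) with hGm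
  have hGpt : Gp ≠ ⊤ := hg'i.lintegral_lt_top.ne
  have hGmt : Gm ≠ ⊤ := hg'i.neg.lintegral_lt_top.ne
  set F : ℝ × X → ℝ≥0∞ := fun p => epos (f p - (g' p.1 : EReal)) with hF
  have hFm : Measurable F := by
    have : Measurable fun p : ℝ × X => f p - (g' p.1 : EReal) := by
      have h1 : Measurable fun p : ℝ × X => ((-g' p.1 : ℝ) : EReal) := by fun_prop
      exact hfBorel.add h1
    exact this.ereal_toENNReal
  have hFl : ∀ t, LowerSemicontinuous fun x => F (t, x) := by
    intro t
    have hc : Continuous fun y : EReal => epos (y - (g' t : EReal)) := by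
      refine EReal.continuous_toENNReal.comp ?_
      rw [continuous_iff_continuousAt]
      intro y
      have h1 : ContinuousAt (fun p : EReal × EReal => p.1 + p.2) (y, ((-g' t : ℝ) : EReal)) :=
        EReal.continuousAt_add (Or.inr (EReal.coe_ne_bot _)) (Or.inr (EReal.coe_ne_top _))
      have h2 : ContinuousAt (fun y : EReal => (y, ((-g' t : ℝ) : EReal))) y := by fun_prop
      exact ContinuousAt.comp (f := fun y : EReal => (y, ((-g' t : ℝ) : EReal))) h1 h2
    refine hc.comp_lowerSemicontinuous (hfnormal t) ?_
    intro y z hyz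
    exact EReal.toENNReal_le_toENNReal (EReal.sub_le_sub hyz le_rfl)
  set M : ℝ := C - (Gp.toReal - Gm.toReal) with hM
  -- reformulation of the energy bound
  have hae : ∀ ν : Measure (ℝ × X), ν.map Prod.fst = lam a b →
      ∀ᵐ p ∂ν, p.1 ∈ Icc a b ∧ g p.1 = g' p.1 := by
    intro ν hν
    exact ae_of_ae_map measurable_fst.aemeasurable (hν ▸ hgg')
  have hkey : ∀ ν : Measure (ℝ × X), ν.map Prod.fst = lam a b →
      (eInt ν f ≤ (C : EReal) ↔ ∫⁻ p, F p ∂ν ≤ ENNReal.ofReal M ∧ 0 ≤ M) := by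
    intro ν hν
    have hge : ∀ᵐ p ∂ν, (g' p.1 : EReal) ≤ f p := by
      filter_upwards [hae ν hν] with p hp
      refine le_trans ?_ (hbound p.1 hp.1 p.2)
      rw [← hp.2]
      have := mul_nonneg (hl0 p.2) (by positivity : 0 ≤ 1 + dist p.2 x₀)
      exact_mod_cast (by linarith : g p.1 ≤ l p.2 * (1 + dist p.2 x₀) + g p.1)
    have hp1 : ∫⁻ p, ENNReal.ofReal (g' p.1) ∂ν = Gp := by
      rw [hGp, ← hν, lintegral_map (by fun_prop) measurable_fst]
    have hp2 : ∫⁻ p, ENNReal.ofReal (-g' p.1) ∂ν = Gm := by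
      rw [hGm, ← hν, lintegral_map (by fun_prop) measurable_fst]
    have hnm : Measurable fun p => epos (-f p) := by
      exact (hfBorel.neg).ereal_toENNReal
    refine ereal_arith _ _ _ _ _ ?_ ?_ hGpt hGmt C
    · rw [← hp1, ← hp2, ← lintegral_add_right _ (by fun_prop), ← lintegral_add_right _ (by fun_prop),
        ← lintegral_add_right _ hnm]
      refine lintegral_congr_ae ?_
      filter_upwards [hge] with p hp
      exact epos_identity _ _ hp
    · refine ne_top_of_le_ne_top hGmt ?_
      rw [← hp2]
      refine lintegral_mono_ae ?_
      filter_upwards [hge] with p hp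
      exact EReal.toENNReal_le_toENNReal (EReal.neg_le_neg_iff.2 hp)
  have hM0 : 0 ≤ M := ((hkey _ (hmap 0)).1 (hηs 0).2).2
  have hFs : ∀ n, ∫⁻ p, F p ∂(ηs n) ≤ ENNReal.ofReal M :=
    fun n => ((hkey _ (hmap n)).1 (hηs n).2).1
  -- the coercive lower bound
  have hlsc := lsc_L l hl0 (lsc_of_compact l hlproper) x₀
  set L : ℝ × X → ℝ := fun p => l p.2 * (1 + dist p.2 x₀) with hLdef
  have hL0 : ∀ p, 0 ≤ L p := fun p => mul_nonneg (hl0 _) (by positivity)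
  have hLm : Measurable L := hlsc.measurable.comp measurable_snd
  have hLF : ∀ ν : Measure (ℝ × X), ν.map Prod.fst = lam a b → ∫⁻ p, F p ∂ν ≤ ENNReal.ofReal M →
      ∫⁻ p, ENNReal.ofReal (L p) ∂ν ≤ ENNReal.ofReal M := by
    intro ν hν hνF
    refine le_trans (lintegral_mono_ae ?_) hνF
    filter_upwards [hae ν hν] with p hp
    have h1 := EReal.sub_le_sub (hbound p.1 hp.1 p.2) (le_refl ((g' p.1 : ℝ) : EReal))
    have h2 : ((l p.2 * (1 + dist p.2 x₀) + g p.1 : ℝ) : EReal) - ((g' p.1 : ℝ) : EReal)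
        = ((L p : ℝ) : EReal) := by
      rw [hp.2, ← EReal.coe_sub]
      simp [hLdef]
    rw [h2] at h1
    exact EReal.toENNReal_le_toENNReal h1
  have hLint : ∀ ν : Measure (ℝ × X), ∫⁻ p, ENNReal.ofReal (L p) ∂ν ≤ ENNReal.ofReal M →
      Integrable L ν := by
    intro ν hν
    refine ⟨hLm.aestronglyMeasurable, ?_⟩
    rw [hasFiniteIntegral_iff_ofReal (Eventually.of_forall hL0)]
    exact hν.trans_lt ENNReal.ofReal_lt_top
  have hlin : ∀ ν : Measure (ℝ × X), IsProbabilityMeasure ν → Integrable L ν →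
      ∀ (h : ℝ × X → ℝ), Continuous h → ∀ K : ℝ, (∀ p, |h p| ≤ K * (1 + dist x₀ p.2)) →
      Integrable h ν := by
    intro ν _ hν h hc K hK
    have hK0 : 0 ≤ K := by
      by_contra! hneg
      have := (abs_nonneg _).trans (hK (0, x₀))
      simp at this; linarith
    obtain ⟨R, hR0, hR⟩ := exists_bound l hlproper x₀ 1
    refine Integrable.mono' (g := fun p => K * ((1 + R) + L p))
      (((integrable_const _).add hν).const_mul K) hc.aestronglyMeasurable
      (Eventually.of_forall fun p => ?_)
    rw [Real.norm_eq_abs]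
    refine (hK p).trans (mul_le_mul_of_nonneg_left ?_ hK0)
    rw [dist_comm]
    have hd : (0 : ℝ) ≤ dist p.2 x₀ := dist_nonneg
    rcases le_or_gt (l p.2) 1 with h2 | h2
    · have := hR _ h2
      have := hL0 p
      linarith
    · have : 1 * (1 + dist p.2 x₀) ≤ L p := by
        simp only [hLdef]; gcongr
      linarith
  have hLs : ∀ n, ∫⁻ p, ENNReal.ofReal (L p) ∂(ηs n) ≤ ENNReal.ofReal M :=
    fun n => hLF _ (hmap n) (hFs n)
  -- tightness and Prokhorov
  let P : ℕ → ProbabilityMeasure (ℝ × X) := fun n => ⟨ηs n, hprob n⟩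
  have htight : IsTightMeasureSet {((μ : ProbabilityMeasure (ℝ × X)) : Measure (ℝ × X)) |
      μ ∈ range P} := by
    rw [isTightMeasureSet_iff_exists_isCompact_measure_compl_le]
    intro ε hε
    obtain ⟨k, hk⟩ := ENNReal.exists_nat_mul_gt hε.ne' (ENNReal.ofReal_ne_top (r := M))
    refine ⟨Icc a b ×ˢ {x | l x ≤ k}, isCompact_Icc.prod (hlproper k), ?_⟩
    rintro _ ⟨_, ⟨n, rfl⟩, rfl⟩
    change ηs n _ ≤ ε
    have hk0 : (k : ℝ≥0∞) ≠ 0 := by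
      rintro h0
      rw [h0, zero_mul] at hk
      exact absurd hk (by simp)
    have h1 : (k : ℝ≥0∞) * ηs n {p | (k : ℝ≥0∞) ≤ ENNReal.ofReal (L p)} ≤ k * ε :=
      (mul_meas_ge_le_lintegral (by fun_prop) _).trans ((hLs n).trans hk.le)
    rw [ENNReal.mul_le_mul_iff_right hk0 (ENNReal.natCast_ne_top k)] at h1
    refine le_trans (measure_mono_ae ?_) h1
    filter_upwards [hae _ (hmap n)] with p hp hpK
    have h2 : (k : ℝ) < l p.2 := by
      by_contra! hle
      exact hpK ⟨hp.1, hle⟩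
    change (k : ℝ≥0∞) ≤ ENNReal.ofReal (L p)
    rw [← ENNReal.ofReal_natCast]
    apply ENNReal.ofReal_le_ofReal
    have h3 : (0 : ℝ) ≤ dist p.2 x₀ := dist_nonneg
    simp only [hLdef]
    nlinarith [hl0 p.2, mul_nonneg (hl0 p.2) h3]
  have hcomp := isCompact_closure_of_isTightMeasureSet htight
  obtain ⟨Q, -, φ, hφ, hlim⟩ := hcomp.tendsto_subseq (x := P)
    (fun n => subset_closure (mem_range_self n))
  have hQmap : (Q : Measure (ℝ × X)).map Prod.fst = lam a b := by
    have h1 := ((ProbabilityMeasure.continuous_map (Ω := ℝ × X) (Ω' := ℝ)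
      continuous_fst).tendsto Q).comp hlim
    let Λ : ProbabilityMeasure ℝ := ⟨lam a b, by
      rw [← hmap 0]; exact Measure.isProbabilityMeasure_map measurable_fst.aemeasurable⟩
    have h2 : ∀ n, (P n).map continuous_fst.measurable.aemeasurable = Λ := by
      intro n
      apply Subtype.ext
      exact hmap n
    have h3 : Tendsto (fun _ : ℕ => Λ) atTop
        (𝓝 (Q.map continuous_fst.measurable.aemeasurable)) := by
      refine h1.congr fun n => ?_
      exact h2 (φ n)
    have h4 := tendsto_nhds_unique h3 tendsto_const_nhds
    exact congrArg Subtype.val h4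
  have hopen : ∀ G, IsOpen G → (Q : Measure (ℝ × X)) G ≤
      atTop.liminf (fun n => ηs (φ n) G) := fun G hG =>
    ProbabilityMeasure.le_liminf_measure_open_of_tendsto hlim hG
  have hQF : ∫⁻ p, F p ∂(Q : Measure (ℝ × X)) ≤ ENNReal.ofReal M := by
    refine (lintegral_le_liminf (lam a b) _ (fun n => ηs (φ n)) (fun n => hmap (φ n)) hopen
      F hFm hFl).trans ?_
    refine (liminf_le_liminf (v := fun _ => ENNReal.ofReal M)
      (Eventually.of_forall fun n => hFs (φ n))).trans ?_
    simp
  have hQL := hLint _ (hLF _ hQmap hQF)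
  have hsL : ∀ n, Integrable L (ηs n) := fun n => hLint _ (hLs n)
  have hsLM : ∀ n, ∫ p, L p ∂(ηs n) ≤ M := by
    intro n
    have := hLs n
    rw [← ofReal_integral_eq_lintegral_ofReal (hsL n) (Eventually.of_forall hL0)] at this
    exact (ENNReal.ofReal_le_ofReal_iff hM0).1 this
  refine ⟨φ, hφ, (Q : Measure (ℝ × X)), ⟨inferInstance, hQmap, ?_⟩,
    (hkey _ hQmap).2 ⟨hQF, hM0⟩, ?_⟩
  · refine hlin _ inferInstance hQL _ (by fun_prop) 1 fun p => ?_
    rw [abs_of_nonneg dist_nonneg]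
    linarith
  · rintro h hc ⟨K, hK⟩
    have hos : ∀ h : ℝ × X → ℝ, Continuous h → (∀ p, |h p| ≤ K * (1 + dist x₀ p.2)) →
        ∀ ε : ℝ, 0 < ε → ∀ᶠ n in atTop,
          ∫ p, h p ∂(Q : Measure (ℝ × X)) < ∫ p, h p ∂(ηs (φ n)) + ε := by
      intro h hc hK ε hε
      exact one_sided (lam a b) _ (fun n => ηs (φ n)) (fun n => hmap (φ n))
        (fun n => hprob (φ n)) hopen l hl0 hlproper x₀ M hM0 hQL (fun n => hsL (φ n))
        (fun n => hsLM (φ n)) h hc K hK (hlin _ inferInstance hQL h hc K hK)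
        (fun n => hlin _ (hprob _) (hsL _) h hc K hK) ε hε
    rw [Metric.tendsto_nhds]
    intro ε hε
    filter_upwards [hos h hc hK ε hε,
      hos (fun p => -h p) hc.neg (fun p => by rw [abs_neg]; exact hK p) ε hε] with n h1 h2
    rw [integral_neg, integral_neg] at h2
    rw [Real.dist_eq, abs_lt]
    constructor <;> linarith
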